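/- arXiv:2512.03733 — 3 statements merged into one kernel-verified Lean document; each statement's English description precedes it below -/
import Mathlib

section
/- Let M ≥ 1, N ≥ 1 and R ≥ 2 be integers and let ω_0, …, ω_{N−1} ∈ [−1/2, N − 1/2) be given frequencies. Let μ be the product probability measure on [0,1)^M of M copies of Lebesgue measure restricted to [0,1) (so the coordinates x_0, …, x_{M−1} are i.i.d. uniform random variables on [0,1)). Define the random matrix E ∈ ℂ^{M×N} by E(j,k) = e^{2πi x_j ω_k} − ∑_{ℓ ∈ I_{N,R}} G(ω_k − ℓ) e^{2πi ℓ x_j}. Then (i) the expectation 𝔼_μ[E(j,k)] = 0 for every 0 ≤ j ≤ M−1 and 0 ≤ k ≤ N−1, and (ii) 𝔼_μ[∑_{j=0}^{M−1} ∑_{k=0}^{N−1} |E(j,k)|²] ≤ (2/(π²(R − 3/2))) · M · N. -/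
open MeasureTheory

/-- The kernel `G(t) = e^{πit} · sin(πt)/(πt)` for `t ≠ 0`, with `G(0) = 1`. -/
noncomputable def G (t : ℝ) : ℂ :=
  if t = 0 then 1
  else Complex.exp (Real.pi * Complex.I * t) * (Real.sin (Real.pi * t) : ℂ) / ((Real.pi * t : ℝ) : ℂ)

theorem integral_exp_eq_G (t : ℝ) :
    ∫ x in (0 : ℝ)..1, Complex.exp (2 * Real.pi * Complex.I * t * x) = G t := by
  by_cases ht : t = 0
  · simp [ht, G]
  have hπ : (Real.pi : ℂ) ≠ 0 := Complex.ofReal_ne_zero.mpr Real.pi_ne_zero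
  have htc : (t : ℂ) ≠ 0 := Complex.ofReal_ne_zero.mpr ht
  have hc : (2 * Real.pi * Complex.I * t : ℂ) ≠ 0 := by simp [hπ, htc]
  rw [integral_exp_mul_complex hc, G, if_neg ht]
  push_cast
  have h1 : (2 * Real.pi * Complex.I * t * 1 : ℂ)
      = Real.pi * Complex.I * t + (Real.pi * t) * Complex.I := by ring
  have h2 : (Real.pi * Complex.I * t : ℂ) = (Real.pi * t) * Complex.I := by ring
  have h3 : Complex.exp (-(Real.pi * t) * Complex.I) * Complex.exp ((Real.pi * t) * Complex.I)
      = 1 := by rw [← Complex.exp_add]; simp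
  rw [h1, Complex.sin, Complex.exp_add, h2, mul_zero, Complex.exp_zero, ← h3]
  field_simp
  rw [Complex.I_sq]
  ring

theorem G_intCast (m : ℤ) : G (m : ℝ) = if m = 0 then 1 else 0 := by
  by_cases hm : m = 0
  · simp [hm, G]
  · have : Real.sin (Real.pi * m) = 0 := by rw [mul_comm]; exact Real.sin_int_mul_pi m
    simp [G, hm, -Complex.ofReal_sin, this]

theorem norm_G_sq_le {t : ℝ} (ht : t ≠ 0) : ‖G t‖ ^ 2 ≤ 1 / (Real.pi * t) ^ 2 := by
  have h1 : ‖Complex.exp (Real.pi * Complex.I * t)‖ = 1 := by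
    rw [show (Real.pi * Complex.I * t : ℂ) = ((Real.pi * t : ℝ) : ℂ) * Complex.I by
      push_cast; ring]
    exact Complex.norm_exp_ofReal_mul_I _
  rw [G, if_neg ht, norm_div, norm_mul, h1, one_mul, Complex.norm_real, Complex.norm_real,
    div_pow, Real.norm_eq_abs, Real.norm_eq_abs, sq_abs, sq_abs]
  gcongr
  exact Real.sin_sq_le_one _

theorem norm_G_sq_le_telescope {t a : ℝ} (ha : 0 < a) (ht : a + 1 / 2 ≤ |t|) :
    ‖G t‖ ^ 2 ≤ 1 / Real.pi ^ 2 * (1 / a - 1 / (a + 1)) := by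
  have ht0 : t ≠ 0 := abs_pos.mp (by linarith)
  refine (norm_G_sq_le ht0).trans ?_
  have h : a * (a + 1) ≤ t ^ 2 := by
    rw [← sq_abs t]
    nlinarith
  calc 1 / (Real.pi * t) ^ 2 = 1 / Real.pi ^ 2 * (1 / t ^ 2) := by
        rw [mul_pow, one_div_mul_one_div]
    _ ≤ 1 / Real.pi ^ 2 * (1 / (a * (a + 1))) := by gcongr
    _ = 1 / Real.pi ^ 2 * (1 / a - 1 / (a + 1)) := by
        congr 1; field_simp; ring

/-- The error of the truncated Fourier expansion of `x ↦ e^{2πixw}` with frequencies in `s`. -/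
noncomputable def truncationError (s : Finset ℤ) (w x : ℝ) : ℂ :=
  Complex.exp (2 * Real.pi * Complex.I * x * w) -
    ∑ ℓ ∈ s, G (w - ℓ) * Complex.exp (2 * Real.pi * Complex.I * ℓ * x)

@[fun_prop]
theorem continuous_truncationError (s : Finset ℤ) (w : ℝ) :
    Continuous (truncationError s w) := by
  unfold truncationError
  fun_prop

theorem integral_exp_mul_truncationError (s : Finset ℤ) (w : ℝ) (n : ℤ) :
    ∫ x in (0 : ℝ)..1, Complex.exp (-(2 * Real.pi * Complex.I * n * x)) * truncationError s w x
      = if n ∈ s then 0 else G (w - n) := by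
  have h : ∀ x : ℝ,
      Complex.exp (-(2 * Real.pi * Complex.I * n * x)) * truncationError s w x =
      Complex.exp (2 * Real.pi * Complex.I * (w - n : ℝ) * x) -
        ∑ ℓ ∈ s, G (w - ℓ) * Complex.exp (2 * Real.pi * Complex.I * ((ℓ - n : ℤ) : ℝ) * x) := by
    intro x
    rw [truncationError, mul_sub, Finset.mul_sum, ← Complex.exp_add]
    congr 1
    · congr 1; push_cast; ring
    · refine Finset.sum_congr rfl fun ℓ _ => ?_
      rw [mul_left_comm, ← Complex.exp_add]
      congr 2; push_cast; ring
  simp_rw [h]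
  rw [intervalIntegral.integral_sub
      (Continuous.intervalIntegrable (by fun_prop) _ _)
      (Continuous.intervalIntegrable (by fun_prop) _ _),
    intervalIntegral.integral_finsetSum
      fun _ _ => Continuous.intervalIntegrable (by fun_prop) _ _]
  simp_rw [intervalIntegral.integral_const_mul, integral_exp_eq_G, G_intCast, sub_eq_zero]
  rw [Finset.sum_congr rfl fun ℓ _ => mul_ite (ℓ = n) (G (w - ℓ)) 1 0]
  by_cases hn : n ∈ s <;> simp [hn]

theorem hasSum_sq_truncationError (s : Finset ℤ) (w : ℝ) :
    HasSum (fun n : ℤ => ‖if n ∈ s then 0 else G (w - n)‖ ^ 2)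
      (∫ x in (0 : ℝ)..1, ‖truncationError s w x‖ ^ 2) := by
  have hL2 : MemLp (truncationError s w) 2 (volume.restrict (Set.Ioc (0 : ℝ) 1)) := by
    rw [memLp_two_iff_integrable_sq_norm (by fun_prop)]
    exact (Continuous.integrableOn_Icc (by fun_prop)).mono_set Set.Ioc_subset_Icc_self
  have h := hasSum_sq_fourierCoeffOn zero_lt_one hL2
  rw [sub_zero, inv_one, one_smul] at h
  convert h using 4 with n
  rw [fourierCoeffOn_eq_integral, ← integral_exp_mul_truncationError]
  simp only [fourier_coe_apply, smul_eq_mul]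
  simp

theorem sum_sq_G_tail_le {N R : ℕ} (hR : 0 < R) {w : ℝ}
    (hw : w ∈ Set.Ico (-(1 : ℝ) / 2) ((N : ℝ) - 1 / 2)) (n : ℕ) :
    ∑ k ∈ Finset.Icc (-(R : ℤ) - n) ((N : ℤ) - 1 + R + n),
      ‖if k ∈ Finset.Icc (-(R : ℤ)) ((N : ℤ) - 1 + R) then 0 else G (w - k)‖ ^ 2
      ≤ 2 / Real.pi ^ 2 * (1 / (R : ℝ) - 1 / ((R : ℝ) + n)) := by
  have hR' : (0 : ℝ) < R := by exact_mod_cast hR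
  induction n with
  | zero =>
    refine le_of_eq ?_
    rw [Finset.sum_eq_zero]
    · simp
    · intro k hk
      rw [if_pos (by simpa using hk)]
      simp
  | succ n ih =>
    have hset : Finset.Icc (-(R : ℤ) - (n + 1 : ℕ)) ((N : ℤ) - 1 + R + (n + 1 : ℕ)) =
        insert (-(R : ℤ) - (n + 1 : ℕ)) (insert ((N : ℤ) - 1 + R + (n + 1 : ℕ))
          (Finset.Icc (-(R : ℤ) - n) ((N : ℤ) - 1 + R + n))) := by
      ext k
      simp only [Finset.mem_insert, Finset.mem_Icc]
      omega
    have ha : (0 : ℝ) < (R : ℝ) + n := by positivity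
    obtain ⟨hw1, hw2⟩ := hw
    have b1 : ‖G (w - ((-(R : ℤ) - (n + 1 : ℕ) : ℤ) : ℝ))‖ ^ 2 ≤ _ :=
      norm_G_sq_le_telescope ha (by
        refine le_trans ?_ (le_abs_self _)
        push_cast
        linarith)
    have b2 : ‖G (w - (((N : ℤ) - 1 + R + (n + 1 : ℕ) : ℤ) : ℝ))‖ ^ 2 ≤ _ :=
      norm_G_sq_le_telescope ha (by
        refine le_trans ?_ (neg_le_abs _)
        push_cast
        linarith)
    rw [hset, Finset.sum_insert (by simp only [Finset.mem_insert, Finset.mem_Icc]; omega),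
      Finset.sum_insert (by simp only [Finset.mem_Icc]; omega),
      if_neg (by simp only [Finset.mem_Icc]; omega),
      if_neg (by simp only [Finset.mem_Icc]; omega)]
    refine (add_le_add b1 (add_le_add b2 ih)).trans_eq ?_
    push_cast
    ring

theorem integral_sq_truncationError_le {N R : ℕ} (hR : 0 < R) {w : ℝ}
    (hw : w ∈ Set.Ico (-(1 : ℝ) / 2) ((N : ℝ) - 1 / 2)) :
    ∫ x in (0 : ℝ)..1, ‖truncationError (Finset.Icc (-(R : ℤ)) ((N : ℤ) - 1 + R)) w x‖ ^ 2
      ≤ 2 / (Real.pi ^ 2 * R) := by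
  refine hasSum_le_of_sum_le (hasSum_sq_truncationError _ w) fun s => ?_
  set n := ∑ k ∈ s, k.natAbs
  have hs : s ⊆ Finset.Icc (-(R : ℤ) - n) ((N : ℤ) - 1 + R + n) := by
    intro k hk
    have : k.natAbs ≤ n := Finset.single_le_sum (f := Int.natAbs) (fun _ _ => Nat.zero_le _) hk
    rw [Finset.mem_Icc]
    omega
  refine (Finset.sum_le_sum_of_subset_of_nonneg hs fun _ _ _ => by positivity).trans ?_
  refine (sum_sq_G_tail_le hR hw n).trans ?_
  have : 0 ≤ 1 / ((R : ℝ) + n) := by positivity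
  calc 2 / Real.pi ^ 2 * (1 / (R : ℝ) - 1 / ((R : ℝ) + n))
      ≤ 2 / Real.pi ^ 2 * (1 / (R : ℝ)) := by gcongr; linarith
    _ = 2 / (Real.pi ^ 2 * R) := by rw [div_mul_div_comm, mul_one]

theorem integral_pi_uniform_comp_eval {ι F : Type*} [Fintype ι] [NormedAddCommGroup F]
    [NormedSpace ℝ F] [SecondCountableTopologyEither ℝ F] {f : ℝ → F} (hf : Continuous f) (i : ι) :
    ∫ x, f (x i) ∂(Measure.pi fun _ : ι => volume.restrict (Set.Ico (0 : ℝ) 1)) =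
      ∫ x in (0 : ℝ)..1, f x := by
  have : IsProbabilityMeasure (volume.restrict (Set.Ico (0 : ℝ) 1)) := ⟨by simp⟩
  rw [integral_comp_eval (μ := fun _ : ι => volume.restrict (Set.Ico (0 : ℝ) 1))
    hf.aestronglyMeasurable, intervalIntegral.integral_of_le zero_le_one,
    integral_Ico_eq_integral_Ioc]

theorem integrable_pi_uniform_comp_eval {ι F : Type*} [Fintype ι] [NormedAddCommGroup F]
    {f : ℝ → F} (hf : Continuous f) (i : ι) :
    Integrable (fun x : ι → ℝ => f (x i))
      (Measure.pi fun _ : ι => volume.restrict (Set.Ico (0 : ℝ) 1)) :=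
  integrable_comp_eval (μ := fun _ : ι => volume.restrict (Set.Ico (0 : ℝ) 1))
    (hf.integrableOn_Icc.mono_set Set.Ico_subset_Icc_self)

theorem nudft3_error_matrix_mean_zero_and_frobenius_bound
    (M N R : ℕ) (hM : 1 ≤ M) (hN : 1 ≤ N) (hR : 2 ≤ R)
    (ω : Fin N → ℝ) (hω : ∀ k, ω k ∈ Set.Ico (-(1 : ℝ) / 2) ((N : ℝ) - 1 / 2)) :
    let μ : Measure (Fin M → ℝ) := Measure.pi fun _ => volume.restrict (Set.Ico (0 : ℝ) 1)
    let E : (Fin M → ℝ) → Fin M → Fin N → ℂ := fun x j k =>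
      Complex.exp (2 * Real.pi * Complex.I * x j * ω k) -
        ∑ ℓ ∈ Finset.Icc (-(R : ℤ)) ((N : ℤ) - 1 + R),
          G (ω k - ℓ) * Complex.exp (2 * Real.pi * Complex.I * ℓ * x j)
    (∀ (j : Fin M) (k : Fin N), (∫ x, E x j k ∂μ) = 0) ∧
    (∫ x, ∑ j, ∑ k, ‖E x j k‖ ^ 2 ∂μ) ≤
      2 / (Real.pi ^ 2 * ((R : ℝ) - 3 / 2)) * M * N := by
  intro μ E
  set s := Finset.Icc (-(R : ℤ)) ((N : ℤ) - 1 + R)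
  have hE : ∀ x j k, E x j k = truncationError s (ω k) (x j) := fun _ _ _ => rfl
  have hcont : ∀ k, Continuous fun y => ‖truncationError s (ω k) y‖ ^ 2 := fun k => by fun_prop
  simp_rw [hE]
  constructor
  · intro j k
    have h0 : (0 : ℤ) ∈ s := by simp only [s, Finset.mem_Icc]; omega
    rw [integral_pi_uniform_comp_eval (continuous_truncationError s (ω k)) j]
    simpa [h0] using integral_exp_mul_truncationError s (ω k) 0
  have hint : ∀ (j : Fin M) (k : Fin N),
      Integrable (fun x : Fin M → ℝ => ‖truncationError s (ω k) (x j)‖ ^ 2) μ := fun j k =>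
    integrable_pi_uniform_comp_eval (hcont k) j
  have hR' : (2 : ℝ) ≤ R := by exact_mod_cast hR
  have hbound : ∀ (j : Fin M) (k : Fin N),
      ∫ x : Fin M → ℝ, ‖truncationError s (ω k) (x j)‖ ^ 2 ∂μ
        ≤ 2 / (Real.pi ^ 2 * ((R : ℝ) - 3 / 2)) := by
    intro j k
    rw [integral_pi_uniform_comp_eval (hcont k) j]
    refine (integral_sq_truncationError_le (by omega) (hω k)).trans ?_
    have : 0 < (R : ℝ) - 3 / 2 := by linarith
    gcongr
    linarith
  rw [integral_finsetSum _ fun j _ => integrable_finsetSum _ fun k _ => hint j k]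
  simp_rw [integral_finsetSum _ fun k _ => hint _ k]
  refine (Finset.sum_le_sum fun j _ => Finset.sum_le_sum fun k _ => hbound j k).trans_eq ?_
  simp only [Finset.sum_const, Finset.card_univ, Fintype.card_fin, nsmul_eq_mul]
  ring
end

section
/- Let ω ∈ ℝ, let p ∈ ℤ satisfy |ω − p| ≤ 1/2, and let R ≥ 2 be an integer. Then ∑_{ℓ ∈ ℤ, |ℓ − p| ≥ R} sin²(π(ω − ℓ)) / (π²(ω − ℓ)²) ≤ 2/(π²(R − 3/2)). -/
/-- The telescoping sum `∑ₙ (1 / (a + n) - 1 / (a + n + 1))` equals `1 / a` for `a > 0`. -/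
theorem hasSum_one_div_add_sub_one_div_add_succ {a : ℝ} (ha : 0 < a) :
    HasSum (fun n : ℕ => 1 / (a + n) - 1 / (a + (n + 1 : ℕ))) (1 / a) := by
  rw [hasSum_iff_tendsto_nat_of_nonneg]
  · simp_rw [Finset.sum_range_sub' (fun n : ℕ => 1 / (a + (n : ℝ)))]
    have h : Filter.Tendsto (fun n : ℕ => 1 / (a + (n : ℝ))) Filter.atTop (nhds 0) := by
      simp_rw [one_div]
      exact tendsto_inv_atTop_zero.comp
        (Filter.tendsto_atTop_add_const_left _ a tendsto_natCast_atTop_atTop)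
    simpa using h.const_sub (1 / a)
  · intro n
    rw [sub_nonneg]
    push_cast
    gcongr
    linarith

/-- A telescoping bound for `sin² (πx) / (πx)²` in terms of a lower bound for `|x|`. -/
theorem sin_sq_div_pi_sq_mul_sq_le {x y : ℝ} (hy : 3 / 2 < y) (hx : y - 1 / 2 ≤ |x|) :
    Real.sin (Real.pi * x) ^ 2 / (Real.pi ^ 2 * x ^ 2) ≤
      1 / Real.pi ^ 2 * (1 / (y - 3 / 2) - 1 / (y - 1 / 2)) := by
  have h₁ : 0 < y - 3 / 2 := by linarith
  have h₂ : 0 < y - 1 / 2 := by linarith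
  have hsq : (y - 3 / 2) * (y - 1 / 2) ≤ x ^ 2 := by
    rw [← sq_abs x]
    nlinarith
  have heq : 1 / (y - 3 / 2) - 1 / (y - 1 / 2) = 1 / ((y - 3 / 2) * (y - 1 / 2)) := by
    rw [div_sub_div _ _ h₁.ne' h₂.ne']
    ring
  rw [heq, one_div_mul_one_div]
  have hπ := Real.pi_pos
  gcongr
  exact Real.sin_sq_le_one _

theorem tail_sum_fourier_coeff_sq_le (ω : ℝ) (p : ℤ) (hp : |ω - p| ≤ 1 / 2)
    (R : ℤ) (hR : 2 ≤ R) :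
    (Summable fun ℓ : {ℓ : ℤ // R ≤ |ℓ - p|} =>
      Real.sin (Real.pi * (ω - ℓ.1)) ^ 2 / (Real.pi ^ 2 * (ω - (ℓ.1 : ℝ)) ^ 2)) ∧
    ∑' ℓ : {ℓ : ℤ // R ≤ |ℓ - p|},
        Real.sin (Real.pi * (ω - ℓ.1)) ^ 2 / (Real.pi ^ 2 * (ω - (ℓ.1 : ℝ)) ^ 2) ≤
      2 / (Real.pi ^ 2 * ((R : ℝ) - 3 / 2)) := by
  have hR' : (2 : ℝ) ≤ R := by exact_mod_cast hR
  have ha : (0 : ℝ) < R - 3 / 2 := by linarith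
  let g : ℕ → ℝ := fun n => 1 / Real.pi ^ 2 *
    (1 / ((R : ℝ) - 3 / 2 + n) - 1 / ((R : ℝ) - 3 / 2 + (n + 1 : ℕ)))
  have hg : HasSum g (1 / Real.pi ^ 2 * (1 / ((R : ℝ) - 3 / 2))) :=
    (hasSum_one_div_add_sub_one_div_add_succ ha).mul_left _
  have hg₀ (n : ℕ) : 0 ≤ g n := by
    refine mul_nonneg (by positivity) (sub_nonneg.2 ?_)
    push_cast
    gcongr
    linarith
  let e : {ℓ : ℤ // R ≤ |ℓ - p|} → ℕ ⊕ ℕ := fun ℓ =>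
    if p ≤ ℓ.1 then .inl (|ℓ.1 - p| - R).toNat else .inr (|ℓ.1 - p| - R).toNat
  have he : Function.Injective e := by
    rintro ⟨k, hk⟩ ⟨l, hl⟩ h
    simp only [e] at h
    rw [Subtype.mk.injEq]
    split_ifs at h <;> simp only [Sum.inl.injEq, Sum.inr.injEq] at h <;> grind
  have hG : HasSum (Sum.elim g g) (1 / Real.pi ^ 2 * (1 / ((R : ℝ) - 3 / 2)) +
      1 / Real.pi ^ 2 * (1 / ((R : ℝ) - 3 / 2))) :=
    HasSum.sum (by simpa using hg) (by simpa using hg)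
  have hG₀ : ∀ i, 0 ≤ Sum.elim g g i := by
    rintro (n | n) <;> exact hg₀ n
  have hle (ℓ : {ℓ : ℤ // R ≤ |ℓ - p|}) :
      Real.sin (Real.pi * (ω - ℓ.1)) ^ 2 / (Real.pi ^ 2 * (ω - (ℓ.1 : ℝ)) ^ 2) ≤
        (Sum.elim g g ∘ e) ℓ := by
    obtain ⟨l, hl⟩ := ℓ
    have hn : (((|l - p| - R).toNat : ℕ) : ℝ) = |(l : ℝ) - p| - R := by
      have : (((|l - p| - R).toNat : ℕ) : ℤ) = |l - p| - R := Int.toNat_of_nonneg (by linarith)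
      exact_mod_cast congrArg (Int.cast : ℤ → ℝ) this
    have hl' : (R : ℝ) ≤ |(l : ℝ) - p| := by exact_mod_cast hl
    have hval : (Sum.elim g g ∘ e) ⟨l, hl⟩ = g (|l - p| - R).toNat := by
      simp only [Function.comp, e]
      split_ifs <;> rfl
    have hdist : |(l : ℝ) - p| - 1 / 2 ≤ |ω - l| := by
      have := abs_sub_le (l : ℝ) ω p
      rw [abs_sub_comm (l : ℝ) ω] at this
      linarith
    rw [hval]
    refine (sin_sq_div_pi_sq_mul_sq_le (by linarith) hdist).trans_eq ?_
    simp only [g]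
    push_cast
    rw [hn]
    ring_nf
  have hGe : Summable (Sum.elim g g ∘ e) := hG.summable.comp_injective he
  have hf := hGe.of_nonneg_of_le (fun ℓ => by positivity) hle
  refine ⟨hf, (hf.tsum_le_tsum hle hGe).trans ?_⟩
  refine (tsum_comp_le_tsum_of_inj hG.summable hG₀ he).trans_eq ?_
  rw [hG.tsum_eq]
  field_simp
  norm_num
end

section
/- Let M ≥ 1 and N ≥ 1 be integers, let γ_0, …, γ_{M−1} ∈ ℂ, let A ∈ ℂ^{M×N} with A(j,k) = γ_j^k, let Γ = diag(γ_0, …, γ_{M−1}), let F ∈ ℂ^{N×N} be the DFT matrix F(j,k) = e^{−2πijk/N}, and let a ∈ ℂ^M with a_j = γ_j^N − 1. Set Ã = A F^{−1}, D = diag(F e_1) (so D(k,k) = e^{−2πik/N}), and b = F^{−*} e_{N−1} (the conjugate-transpose of F^{−1} applied to e_{N−1}). Then Γ Ã − Ã D = a b^*. -/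
theorem mul_cyclic_shift_apply {R : Type*} [Semiring R] {m N : ℕ} (hN : 0 < N)
    (X : Matrix (Fin m) (Fin N) R) (j : Fin m) (k : Fin N) :
    (X * Matrix.of fun i l : Fin N => if i = ⟨((l : ℕ) + 1) % N, Nat.mod_lt _ hN⟩ then (1 : R) else 0)
      j k = X j ⟨((k : ℕ) + 1) % N, Nat.mod_lt _ hN⟩ := by
  simp [Matrix.mul_apply]

/-- The displacement equation for any Vandermonde-type matrix after a discrete Fourier transform
built from a primitive root of unity. -/
theorem vandermonde_dft_displacement {K : Type*} [Field K] {M N : ℕ} (hN : 0 < N) {ω : K}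
    (hω : IsPrimitiveRoot ω N) (γ : Fin M → K) (j : Fin M) (k : Fin N) :
    let A : Matrix (Fin M) (Fin N) K := Matrix.of fun j k => γ j ^ (k : ℕ)
    let F : Matrix (Fin N) (Fin N) K := Matrix.vandermonde fun j => ω ^ (j : ℕ)
    (Matrix.diagonal γ * (A * F⁻¹) - A * F⁻¹ * Matrix.diagonal fun k : Fin N => ω ^ (k : ℕ)) j k =
      (γ j ^ N - 1) * F⁻¹ ⟨N - 1, Nat.sub_lt hN one_pos⟩ k := by
  intro A F
  set D : Matrix (Fin N) (Fin N) K := Matrix.diagonal fun k : Fin N => ω ^ (k : ℕ) with hD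
  have hF : IsUnit F.det := by
    refine isUnit_iff_ne_zero.mpr (Matrix.det_vandermonde_ne_zero_iff.mpr fun i l h => ?_)
    exact Fin.ext (hω.pow_inj i.2 l.2 h)
  let Z : Matrix (Fin N) (Fin N) K :=
    Matrix.of fun i l => if i = ⟨((l : ℕ) + 1) % N, Nat.mod_lt _ hN⟩ then 1 else 0
  have hFZ : F * Z = D * F := by
    ext i l
    rw [mul_cyclic_shift_apply hN, hD, Matrix.diagonal_mul]
    have h1 : (ω ^ (i : ℕ)) ^ N = 1 := by rw [← pow_mul, mul_comm, pow_mul, hω.pow_eq_one, one_pow]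
    simp only [F, Matrix.vandermonde_apply]
    rw [← pow_eq_pow_mod _ h1, pow_succ']
  have hZ : F⁻¹ * D = Z * F⁻¹ := by
    calc F⁻¹ * D = F⁻¹ * (D * F) * F⁻¹ := by
          rw [← mul_assoc, Matrix.mul_nonsing_inv_cancel_right _ _ hF]
      _ = Z * F⁻¹ := by rw [← hFZ, Matrix.nonsing_inv_mul_cancel_left _ _ hF]
  have hA : Matrix.diagonal γ * A - A * Z =
      Matrix.of fun j l => if l = ⟨N - 1, Nat.sub_lt hN one_pos⟩ then γ j ^ N - 1 else 0 := by
    ext i l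
    rw [Matrix.sub_apply, mul_cyclic_shift_apply hN, Matrix.diagonal_mul]
    simp only [A, Matrix.of_apply, Fin.ext_iff, ← pow_succ']
    split_ifs with h
    · rw [h, Nat.sub_add_cancel (Nat.one_le_iff_ne_zero.mpr hN.ne'), Nat.mod_self, pow_zero]
    · rw [Nat.mod_eq_of_lt (by omega), sub_self]
  rw [Matrix.mul_assoc A, hZ, ← Matrix.mul_assoc, ← Matrix.mul_assoc, ← Matrix.sub_mul, hA]
  simp [Matrix.mul_apply]

theorem transformed_nudft2_displacement (M N : ℕ) (hM : 1 ≤ M) (hN : 1 ≤ N) (γ : Fin M → ℂ) :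
    let A : Matrix (Fin M) (Fin N) ℂ := Matrix.of fun j k => γ j ^ (k : ℕ)
    let Γ : Matrix (Fin M) (Fin M) ℂ := Matrix.diagonal γ
    let F : Matrix (Fin N) (Fin N) ℂ :=
      Matrix.of fun j k =>
        Complex.exp (-(2 * Real.pi * Complex.I * ((j : ℕ) : ℂ) * ((k : ℕ) : ℂ)) / N)
    let a : Fin M → ℂ := fun j => γ j ^ N - 1
    let Atilde : Matrix (Fin M) (Fin N) ℂ := A * F⁻¹
    let D : Matrix (Fin N) (Fin N) ℂ :=
      Matrix.diagonal fun k => Complex.exp (-(2 * Real.pi * Complex.I * ((k : ℕ) : ℂ)) / N)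
    let e : Fin N → ℂ := fun ℓ => if (ℓ : ℕ) = N - 1 then 1 else 0
    let b : Fin N → ℂ := Matrix.mulVec (Matrix.conjTranspose F⁻¹) e
    Γ * Atilde - Atilde * D = Matrix.of fun j k => a j * (starRingEnd ℂ) (b k) := by
  intro A Γ F a Atilde D e b
  have hω := (Complex.isPrimitiveRoot_exp N (by omega)).inv
  set ω : ℂ := (Complex.exp (2 * Real.pi * Complex.I / N))⁻¹ with hω_def
  have hpow (n : ℕ) : ω ^ n = Complex.exp (-(2 * Real.pi * Complex.I * (n : ℂ)) / N) := by
    rw [hω_def, ← Complex.exp_neg, ← Complex.exp_nat_mul]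
    congr 1
    ring
  have hF : F = Matrix.vandermonde fun j : Fin N => ω ^ (j : ℕ) := by
    ext j k
    rw [Matrix.vandermonde_apply, ← pow_mul, hpow]
    simp only [F, Matrix.of_apply]
    push_cast
    rw [mul_assoc _ ((j : ℕ) : ℂ)]
  have hD : D = Matrix.diagonal fun k : Fin N => ω ^ (k : ℕ) := by
    simp only [D, hpow]
  have hb (k : Fin N) : (starRingEnd ℂ) (b k) = F⁻¹ ⟨N - 1, Nat.sub_lt hN one_pos⟩ k := by
    have he (l : Fin N) : e l = if l = ⟨N - 1, Nat.sub_lt hN one_pos⟩ then 1 else 0 := by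
      simp only [e, Fin.ext_iff]
    simp only [b, Matrix.mulVec, dotProduct, he, Matrix.conjTranspose_apply, mul_ite, mul_one,
      mul_zero, Finset.sum_ite_eq', Finset.mem_univ, if_true]
    exact star_star _
  ext j k
  rw [Matrix.of_apply, hb, hD]
  simp only [Atilde, hF]
  exact vandermonde_dft_displacement hN hω γ j k
end
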